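/- Let q ≥ 2 and r ≥ 1, let U₁ ∈ ℝ^{q×r} be a matrix all of whose rows have the same Euclidean norm c ≥ 0, let v ∈ ℝ^q be a unit vector with U₁ᵀ v = 0, and let Q ∈ ℝ^{q×q} be an orthogonal matrix whose last row is vᵀ. Then ‖Q U₁‖_{1,2} ≤ √((q−1)/q) · ‖U₁‖_{1,2}; in particular, if c > 0 then ‖Q U₁‖_{1,2} < ‖U₁‖_{1,2}. -/

import Mathlib

open Matrix Finset

/-- The `(1,2)`-norm of a real matrix: the sum of the Euclidean norms of its rows. -/
noncomputable def norm12 {q r : ℕ} (M : Matrix (Fin q) (Fin r) ℝ) : ℝ :=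
  ∑ i, Real.sqrt (∑ j, (M i j) ^ 2)

theorem sum_sq_eq_trace_transpose_mul_self {m n : Type*} [Fintype m] [Fintype n]
    (M : Matrix m n ℝ) : ∑ i, ∑ j, (M i j) ^ 2 = (Mᵀ * M).trace := by
  rw [Finset.sum_comm]
  simp [Matrix.trace, Matrix.mul_apply, sq]

/-- Left multiplication by a matrix with orthonormal columns preserves the sum of squares of the
entries. -/
theorem sum_sq_mul_of_transpose_mul_self_eq_one {l m n : Type*} [Fintype l] [Fintype m]
    [Fintype n] [DecidableEq m] {Q : Matrix l m ℝ} (hQ : Qᵀ * Q = 1) (M : Matrix m n ℝ) :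
    ∑ i, ∑ j, ((Q * M) i j) ^ 2 = ∑ i, ∑ j, (M i j) ^ 2 := by
  rw [sum_sq_eq_trace_transpose_mul_self, sum_sq_eq_trace_transpose_mul_self,
    Matrix.transpose_mul, Matrix.mul_assoc, ← Matrix.mul_assoc Qᵀ, hQ, Matrix.one_mul]

/-- Cauchy–Schwarz for the row norms of a matrix with a vanishing row. -/
theorem norm12_sq_le_of_row_eq_zero {q r : ℕ} (M : Matrix (Fin q) (Fin r) ℝ) (k : Fin q)
    (hk : M k = 0) :
    norm12 M ^ 2 ≤ ((q : ℝ) - 1) * ∑ i, ∑ j, (M i j) ^ 2 := by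
  have hq : 1 ≤ q := k.pos
  have hsum : norm12 M = ∑ i ∈ univ.erase k, √(∑ j, (M i j) ^ 2) := by
    rw [norm12, Finset.sum_erase]
    simp [hk]
  have hcard : ((univ.erase k).card : ℝ) = (q : ℝ) - 1 := by
    rw [Finset.card_erase_of_mem (mem_univ k), Finset.card_univ, Fintype.card_fin]
    push_cast [hq]
    rfl
  have hsq : ∑ i ∈ univ.erase k, √(∑ j, (M i j) ^ 2) ^ 2 = ∑ i, ∑ j, (M i j) ^ 2 := by
    rw [Finset.sum_erase _ (by simp [hk])]
    exact Finset.sum_congr rfl fun i _ =>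
      Real.sq_sqrt (Finset.sum_nonneg fun j _ => sq_nonneg _)
  rw [hsum, ← hcard, ← hsq]
  exact sq_sum_le_card_mul_sum_sq

/-- The rotation-and-Cauchy–Schwarz reduction step in the proof of Theorem 4. -/
theorem rotation_reduces_row_norm_sum
    (q r : ℕ) (hq : 2 ≤ q) (hr : 1 ≤ r)
    (U₁ : Matrix (Fin q) (Fin r) ℝ) (c : ℝ) (hc : 0 ≤ c)
    (hrows : ∀ i, Real.sqrt (∑ j, (U₁ i j) ^ 2) = c)
    (v : Fin q → ℝ) (hv : ∑ i, (v i) ^ 2 = 1)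
    (hker : U₁ᵀ *ᵥ v = 0)
    (Q : Matrix (Fin q) (Fin q) ℝ) (hQ : Qᵀ * Q = 1)
    (hlast : Q ⟨q - 1, by omega⟩ = v) :
    norm12 (Q * U₁) ≤ Real.sqrt (((q : ℝ) - 1) / q) * norm12 U₁ ∧
      (0 < c → norm12 (Q * U₁) < norm12 U₁) := by
  have hq0 : (0 : ℝ) < q := by exact_mod_cast (by omega : 0 < q)
  have hq1 : (0 : ℝ) ≤ (q : ℝ) - 1 := by
    have : (1 : ℝ) ≤ q := by exact_mod_cast (by omega : 1 ≤ q)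
    linarith
  have hU : norm12 U₁ = q * c := by simp [norm12, hrows]
  have hfrob : ∑ i, ∑ j, (U₁ i j) ^ 2 = q * c ^ 2 := by
    have hrow : ∀ i, ∑ j, (U₁ i j) ^ 2 = c ^ 2 := fun i => by
      rw [← hrows i, Real.sq_sqrt (Finset.sum_nonneg fun j _ => sq_nonneg _)]
    simp [hrow]
  have hzero : (Q * U₁) ⟨q - 1, by omega⟩ = 0 := by
    rw [Matrix.mul_apply_eq_vecMul, hlast, ← Matrix.mulVec_transpose, hker]
  have hle : norm12 (Q * U₁) ≤ √(((q : ℝ) - 1) / q) * norm12 U₁ := by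
    have h := norm12_sq_le_of_row_eq_zero _ _ hzero
    rw [sum_sq_mul_of_transpose_mul_self_eq_one hQ, hfrob] at h
    rw [hU]
    refine le_of_abs_le (abs_le_of_sq_le_sq (h.trans_eq ?_) (by positivity))
    rw [mul_pow, Real.sq_sqrt (div_nonneg hq1 hq0.le)]
    field_simp
  refine ⟨hle, fun hcpos => hle.trans_lt ?_⟩
  have hUpos : 0 < norm12 U₁ := hU ▸ mul_pos hq0 hcpos
  refine mul_lt_of_lt_one_left hUpos ?_
  rw [Real.sqrt_lt' one_pos, one_pow, div_lt_one hq0]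
  linarith
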